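/- arXiv:2310.15561 — 2 statements merged into one kernel-verified Lean document; each statement's English description precedes it below -/
import Mathlib

section
/- A bounded linear operator T on a Banach space satisfies ‖(1/n)∑_{k=1}^n T^k‖ → 0 if and only if ‖T^n‖/n → 0 and the series ∑_{k=1}^∞ T^k x / k converges for every x ∈ X. -/
open Filter Topology

open Polynomial in
theorem isUnit_one_sub_of_norm_aeval_lt {𝕜 : Type*} [RCLike 𝕜]
    {X : Type*} [NormedAddCommGroup X] [NormedSpace 𝕜 X] [CompleteSpace X]
    (T : X →L[𝕜] X) (p : 𝕜[X]) (h : ‖aeval T p‖ < ‖p.eval 1‖) : IsUnit (1 - T) := by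
  by_contra hT
  have h1 : (1 : 𝕜) ∈ spectrum 𝕜 T := by
    rwa [spectrum.mem_iff, map_one]
  have h2 : p.eval 1 ∈ spectrum 𝕜 (aeval T p) :=
    spectrum.subset_polynomial_aeval T p ⟨1, h1, rfl⟩
  have h3 := spectrum.norm_le_norm_mul_of_mem h2
  have h4 : ‖(1 : X →L[𝕜] X)‖ ≤ 1 := ContinuousLinearMap.norm_id_le
  nlinarith [norm_nonneg (aeval T p)]

theorem one_sub_mul_sum_smul_pow {R A : Type*} [CommRing R] [Ring A] [Algebra R A]
    (a : A) (c : ℕ → R) (n : ℕ) :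
    (1 - a) * ∑ k ∈ Finset.range n, c k • a ^ k =
      c 0 • 1 + a * ∑ k ∈ Finset.range n, (c (k + 1) - c k) • a ^ k - c n • a ^ n := by
  induction n with
  | zero => simp
  | succ n ih =>
    rw [Finset.sum_range_succ, Finset.sum_range_succ, mul_add, ih]
    have e : a * (c (n + 1) - c n) • a ^ n = c (n + 1) • a ^ (n + 1) - c n • a ^ (n + 1) := by
      rw [mul_smul_comm, ← pow_succ', sub_smul]
    rw [mul_add a, e, sub_mul, one_mul, mul_smul_comm, ← pow_succ']
    abel

theorem exists_tendsto_sum_smul_pow {𝕜 A : Type*} [NormedField 𝕜] [NormedRing A]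
    [NormedAlgebra 𝕜 A] {a : A} (ha : IsUnit (1 - a)) {c : ℕ → 𝕜}
    (hc : Tendsto (fun n => c n • a ^ n) atTop (𝓝 0))
    (h : ∃ y, Tendsto (fun n => ∑ k ∈ Finset.range n, (c (k + 1) - c k) • a ^ k) atTop (𝓝 y)) :
    ∃ y, Tendsto (fun n => ∑ k ∈ Finset.range n, c k • a ^ k) atTop (𝓝 y) := by
  obtain ⟨b, hb⟩ := ha.exists_left_inv
  obtain ⟨y, hy⟩ := h
  refine ⟨b * (c 0 • 1 + a * y - 0), ?_⟩
  refine ((((hy.const_mul a).const_add (c 0 • 1)).sub hc).const_mul b).congr fun n => ?_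
  rw [← one_sub_mul_sum_smul_pow, ← mul_assoc, hb, one_mul]

theorem exists_tendsto_sum_inv_smul_pow {𝕜 A : Type*} [RCLike 𝕜] [NormedRing A]
    [NormedAlgebra 𝕜 A] [CompleteSpace A] {a : A} (ha : IsUnit (1 - a))
    (h : Tendsto (fun n : ℕ => ‖a ^ n‖ / (n : ℝ)) atTop (𝓝 0)) :
    ∃ y, Tendsto (fun n => ∑ k ∈ Finset.range n, ((k : 𝕜) + 1)⁻¹ • a ^ k) atTop (𝓝 y) := by
  have hne (k m : ℕ) : (k : 𝕜) + (m + 1) ≠ 0 := by exact_mod_cast (k + m).succ_ne_zero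
  have hc0 : Tendsto (fun n : ℕ => ((n : 𝕜) + 1)⁻¹ • a ^ n) atTop (𝓝 0) := by
    refine squeeze_zero_norm' ?_ h
    filter_upwards [eventually_gt_atTop 0] with n hn
    have hn' : (0 : ℝ) < n := by exact_mod_cast hn
    have e : ‖(n : 𝕜) + 1‖ = (n : ℝ) + 1 := by
      exact_mod_cast RCLike.norm_natCast (K := 𝕜) (n + 1)
    rw [norm_smul, norm_inv, e, div_eq_inv_mul]
    gcongr
    linarith
  have hd (k : ℕ) : ((k + 1 : ℕ) + 1 : 𝕜)⁻¹ - ((k : 𝕜) + 1)⁻¹ =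
      -(((k : 𝕜) + 2)⁻¹ * ((k : 𝕜) + 1)⁻¹) := by
    have h1 := hne k 0
    have h2 := hne k 1
    norm_num [add_assoc] at h1 h2 ⊢
    field_simp
    ring
  have hinv (m : ℕ) : Tendsto (fun n : ℕ => ((n : 𝕜) + m)⁻¹) atTop (𝓝 0) := by
    have := (tendsto_add_atTop_iff_nat m).2 (tendsto_inv_atTop_nhds_zero_nat (𝕜 := 𝕜))
    simpa using this
  refine exists_tendsto_sum_smul_pow ha hc0 ?_
  simp only [hd]
  refine exists_tendsto_sum_smul_pow ha ?_ ?_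
  · simpa [mul_smul] using ((hinv 2).smul hc0).neg
  · have hd2 (k : ℕ) : -(((k + 1 : ℕ) + 2 : 𝕜)⁻¹ * ((k + 1 : ℕ) + 1 : 𝕜)⁻¹) -
        -(((k : 𝕜) + 2)⁻¹ * ((k : 𝕜) + 1)⁻¹) =
        (2 * ((k : 𝕜) + 3)⁻¹ * ((k : 𝕜) + 2)⁻¹) * ((k : 𝕜) + 1)⁻¹ := by
      have h1 := hne k 0
      have h2 := hne k 1
      have h3 := hne k 2
      have e2 : (k : 𝕜) + 1 + 1 = k + 2 := by ring
      have e3 : (k : 𝕜) + 1 + 2 = k + 3 := by ring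
      norm_num at h1 h2 h3
      push_cast
      rw [e2, e3]
      field_simp
      ring
    simp only [hd2, mul_smul _ (_ + 1 : 𝕜)⁻¹]
    obtain ⟨C, hC⟩ := hc0.norm.bddAbove_range
    have hs : Summable fun k : ℕ => 2 * C * (1 / ((k + 1 : ℕ) : ℝ) ^ 2) :=
      ((summable_nat_add_iff 1).2 (Real.summable_one_div_nat_pow.2 one_lt_two)).mul_left _
    refine ⟨_, (Summable.of_norm_bounded hs fun k => ?_).hasSum.tendsto_sum_nat⟩
    have hCk : ‖((k : 𝕜) + 1)⁻¹ • a ^ k‖ ≤ C := hC ⟨k, rfl⟩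
    have n2 : ‖(k : 𝕜) + 2‖ = (k : ℝ) + 2 := by
      exact_mod_cast RCLike.norm_natCast (K := 𝕜) (k + 2)
    have n3 : ‖(k : 𝕜) + 3‖ = (k : ℝ) + 3 := by
      exact_mod_cast RCLike.norm_natCast (K := 𝕜) (k + 3)
    rw [norm_smul, norm_mul, norm_mul, norm_inv, norm_inv, n2, n3, RCLike.norm_ofNat]
    calc 2 * ((k : ℝ) + 3)⁻¹ * ((k : ℝ) + 2)⁻¹ * ‖((k : 𝕜) + 1)⁻¹ • a ^ k‖
        ≤ 2 * ((k : ℝ) + 1)⁻¹ * ((k : ℝ) + 1)⁻¹ * C := by gcongr <;> norm_num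
      _ = 2 * C * (1 / ((k + 1 : ℕ) : ℝ) ^ 2) := by
        push_cast
        field_simp

theorem tendsto_norm_pow_div_of_tendsto_cesaro {𝕜 A : Type*} [RCLike 𝕜] [NormedRing A]
    [NormedAlgebra 𝕜 A] {a : A}
    (h : Tendsto (fun n : ℕ => ‖(n : 𝕜)⁻¹ • ∑ k ∈ Finset.Icc 1 n, a ^ k‖) atTop (𝓝 0)) :
    Tendsto (fun n : ℕ => ‖a ^ n‖ / (n : ℝ)) atTop (𝓝 0) := by
  rw [← tendsto_add_atTop_iff_nat 1]
  have h' := ((tendsto_add_atTop_iff_nat 1).2 h).add h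
  rw [add_zero] at h'
  refine squeeze_zero' (Eventually.of_forall fun n => by positivity) ?_ h'
  filter_upwards [eventually_gt_atTop 0] with n hn
  have hn' : (0 : ℝ) < n := by exact_mod_cast hn
  have e : a ^ (n + 1) = ∑ k ∈ Finset.Icc 1 (n + 1), a ^ k - ∑ k ∈ Finset.Icc 1 n, a ^ k := by
    rw [Finset.sum_Icc_succ_top (by omega)]
    abel
  rw [norm_smul, norm_smul, norm_inv, norm_inv, RCLike.norm_natCast, RCLike.norm_natCast,
    div_eq_inv_mul]
  calc ((n + 1 : ℕ) : ℝ)⁻¹ * ‖a ^ (n + 1)‖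
      ≤ ((n + 1 : ℕ) : ℝ)⁻¹ *
        (‖∑ k ∈ Finset.Icc 1 (n + 1), a ^ k‖ + ‖∑ k ∈ Finset.Icc 1 n, a ^ k‖) := by
        rw [e]
        gcongr
        exact norm_sub_le _ _
    _ ≤ _ := by
        rw [mul_add]
        gcongr
        omega

theorem tendsto_cesaro_of_isUnit_one_sub {𝕜 A : Type*} [RCLike 𝕜] [NormedRing A]
    [NormedAlgebra 𝕜 A] {a : A} (ha : IsUnit (1 - a))
    (h : Tendsto (fun n : ℕ => ‖a ^ n‖ / (n : ℝ)) atTop (𝓝 0)) :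
    Tendsto (fun n : ℕ => (n : 𝕜)⁻¹ • ∑ k ∈ Finset.Icc 1 n, a ^ k) atTop (𝓝 0) := by
  obtain ⟨b, hb⟩ := ha.exists_left_inv
  have h0 : Tendsto (fun n : ℕ => (n : 𝕜)⁻¹ • a ^ n) atTop (𝓝 0) := by
    rw [tendsto_zero_iff_norm_tendsto_zero]
    refine h.congr fun n => ?_
    rw [norm_smul, norm_inv, RCLike.norm_natCast, div_eq_inv_mul]
  have h1 := (((tendsto_inv_atTop_nhds_zero_nat (𝕜 := 𝕜)).smul_const a).sub
    (h0.const_mul a)).const_mul b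
  rw [zero_smul, mul_zero, sub_zero, mul_zero] at h1
  refine h1.congr fun n => ?_
  have e : (1 - a) * ∑ k ∈ Finset.Icc 1 n, a ^ k = a - a * a ^ n := by
    induction n with
    | zero => simp
    | succ n ih =>
      rw [Finset.sum_Icc_succ_top (by omega), mul_add, ih]
      simp only [sub_mul, one_mul, ← pow_succ']
      abel
  rw [mul_smul_comm, ← smul_sub, ← e, mul_smul_comm, ← mul_assoc, hb, one_mul]

theorem isUnit_one_sub_of_tendsto_cesaro {𝕜 : Type*} [RCLike 𝕜]
    {X : Type*} [NormedAddCommGroup X] [NormedSpace 𝕜 X] [CompleteSpace X] {T : X →L[𝕜] X}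
    (h : Tendsto (fun n : ℕ => ‖(n : 𝕜)⁻¹ • ∑ k ∈ Finset.Icc 1 n, T ^ k‖) atTop (𝓝 0)) :
    IsUnit (1 - T) := by
  obtain ⟨n, hlt, hn⟩ := ((h.eventually_lt_const one_pos).and (eventually_gt_atTop 0)).exists
  refine isUnit_one_sub_of_norm_aeval_lt T
    ((n : 𝕜)⁻¹ • ∑ k ∈ Finset.Icc 1 n, Polynomial.X ^ k) ?_
  have hn' : (n : 𝕜) ≠ 0 := by exact_mod_cast hn.ne'
  simpa [Polynomial.eval_finsetSum, hn'] using hlt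

theorem isUnit_one_sub_of_tendsto_hilbert {𝕜 : Type*} [RCLike 𝕜]
    {X : Type*} [NormedAddCommGroup X] [NormedSpace 𝕜 X] [CompleteSpace X] {T : X →L[𝕜] X}
    (h : ∀ x : X, ∃ y : X,
      Tendsto (fun n : ℕ => ∑ k ∈ Finset.Icc 1 n, (k : 𝕜)⁻¹ • (T ^ k) x) atTop (𝓝 y)) :
    IsUnit (1 - T) := by
  obtain ⟨C, hC⟩ := banach_steinhaus
    (g := fun n : ℕ => ∑ k ∈ Finset.Icc 1 n, (k : 𝕜)⁻¹ • T ^ k) fun x => by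
      obtain ⟨y, hy⟩ := h x
      obtain ⟨C, hC⟩ := hy.norm.bddAbove_range
      exact ⟨C, fun n => by simpa using hC ⟨n, rfl⟩⟩
  obtain ⟨n, hn⟩ :=
    (Real.tendsto_sum_range_one_div_nat_succ_atTop.eventually_gt_atTop C).exists
  refine isUnit_one_sub_of_norm_aeval_lt T
    (∑ k ∈ Finset.Icc 1 n, (k : 𝕜)⁻¹ • Polynomial.X ^ k) ?_
  have e : ‖∑ k ∈ Finset.Icc 1 n, (k : 𝕜)⁻¹‖ = ∑ k ∈ Finset.range n, 1 / ((k : ℝ) + 1) := by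
    have e1 : ∑ k ∈ Finset.Icc 1 n, (k : 𝕜)⁻¹ =
        ((∑ k ∈ Finset.range n, 1 / ((k : ℝ) + 1) : ℝ) : 𝕜) := by
      clear hn
      induction n with
      | zero => simp
      | succ n ih =>
        rw [Finset.sum_Icc_succ_top (by omega), ih, Finset.sum_range_succ]
        simp
    rw [e1, RCLike.norm_of_nonneg (Finset.sum_nonneg fun k _ => by positivity)]
  have hlt := (hC n).trans_lt hn
  rw [← e] at hlt
  simpa [Polynomial.eval_finsetSum] using hlt

/-- `‖(1/n) ∑_{k=1}^n T^k‖ → 0` if and only if `‖T^n‖/n → 0` and the one-sided ergodic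
Hilbert transform `∑_{k=1}^∞ T^k x / k` converges for every `x ∈ X`. -/
theorem norm_cesaro_tendsto_zero_iff {𝕜 : Type*} [RCLike 𝕜]
    {X : Type*} [NormedAddCommGroup X] [NormedSpace 𝕜 X] [CompleteSpace X]
    (T : X →L[𝕜] X) :
    Tendsto (fun n : ℕ => ‖(n : 𝕜)⁻¹ • ∑ k ∈ Finset.Icc 1 n, T ^ k‖) atTop (𝓝 0) ↔
      (Tendsto (fun n : ℕ => ‖T ^ n‖ / (n : ℝ)) atTop (𝓝 0) ∧
        ∀ x : X, ∃ y : X,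
          Tendsto (fun n : ℕ => ∑ k ∈ Finset.Icc 1 n, (k : 𝕜)⁻¹ • (T ^ k) x) atTop (𝓝 y)) := by
  constructor
  · intro h
    have hT := isUnit_one_sub_of_tendsto_cesaro h
    have hpow := tendsto_norm_pow_div_of_tendsto_cesaro h
    refine ⟨hpow, fun x => ?_⟩
    obtain ⟨L, hL⟩ := exists_tendsto_sum_inv_smul_pow (𝕜 := 𝕜) hT hpow
    have hLx := ((ContinuousLinearMap.apply 𝕜 X x).continuous.tendsto _).comp (hL.const_mul T)
    refine ⟨_, hLx.congr fun n => ?_⟩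
    induction n with
    | zero => simp
    | succ n ih =>
      rw [Finset.sum_Icc_succ_top (by omega), ← ih]
      simp [Finset.sum_range_succ, pow_succ']
  · rintro ⟨hpow, h⟩
    exact tendsto_zero_iff_norm_tendsto_zero.1
      (tendsto_cesaro_of_isUnit_one_sub (isUnit_one_sub_of_tendsto_hilbert h) hpow)
end

section
/- Let T be a bounded linear operator on a Banach space with ‖M_n(T)‖ → 0. Then (1/N)∑_{n=1}^N ∑_{k=0}^{n-1} T^k converges in operator norm to (I-T)^{-1}. -/
open Filter Topology

theorem one_sub_mul_cesaro_geom_sum {𝕜 A : Type*} [Field 𝕜] [CharZero 𝕜] [Ring A] [Algebra 𝕜 A]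
    (a : A) {N : ℕ} (hN : N ≠ 0) :
    (1 - a) * ((N : 𝕜)⁻¹ • ∑ n ∈ Finset.Icc 1 N, ∑ k ∈ Finset.range n, a ^ k) =
      1 - (N : 𝕜)⁻¹ • ∑ k ∈ Finset.Icc 1 N, a ^ k := by
  have hN' : (N : 𝕜) ≠ 0 := Nat.cast_ne_zero.mpr hN
  have hone : (N : 𝕜)⁻¹ • (N : A) = 1 := by
    rw [← map_natCast (algebraMap 𝕜 A), Algebra.algebraMap_eq_smul_one, smul_smul,
      inv_mul_cancel₀ hN', one_smul]
  rw [mul_smul_comm, Finset.mul_sum]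
  simp only [mul_neg_geom_sum, Finset.sum_sub_distrib, smul_sub, Finset.sum_const, Nat.card_Icc,
    Nat.add_sub_cancel, nsmul_one, hone]

/-- If `‖M_n(T)‖ → 0`, then `I - T` is invertible and
`(1/N) ∑_{n=1}^N ∑_{k=0}^{n-1} T^k` converges in operator norm to `(I - T)⁻¹`. -/
theorem cesaro_double_sum_tendsto_inverse {𝕜 : Type*} [RCLike 𝕜]
    {X : Type*} [NormedAddCommGroup X] [NormedSpace 𝕜 X] [CompleteSpace X]
    (T : X →L[𝕜] X)
    (h : Tendsto (fun n : ℕ => ‖(n : 𝕜)⁻¹ • ∑ k ∈ Finset.Icc 1 n, T ^ k‖) atTop (𝓝 0)) :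
    IsUnit (1 - T) ∧
      Tendsto (fun N : ℕ => (N : 𝕜)⁻¹ • ∑ n ∈ Finset.Icc 1 N, ∑ k ∈ Finset.range n, T ^ k)
        atTop (𝓝 (Ring.inverse (1 - T))) := by
  have hlim : Tendsto (fun n : ℕ => 1 - (n : 𝕜)⁻¹ • ∑ k ∈ Finset.Icc 1 n, T ^ k) atTop (𝓝 1) := by
    simpa using (tendsto_zero_iff_norm_tendsto_zero.mpr h).const_sub 1
  have hunit : IsUnit (1 - T) := by
    obtain ⟨N, hN, hN0⟩ := ((hlim.eventually (Units.nhds (1 : (X →L[𝕜] X)ˣ))).and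
      (eventually_ne_atTop 0)).exists
    have hcomm : Commute (1 - T)
        ((N : 𝕜)⁻¹ • ∑ n ∈ Finset.Icc 1 N, ∑ k ∈ Finset.range n, T ^ k) :=
      (Commute.sum_right _ _ _ fun n _ => Commute.sum_right _ _ _ fun k _ =>
        ((Commute.one_left T).sub_left (Commute.refl T)).pow_right k).smul_right _
    refine (hcomm.isUnit_mul_iff.mp ?_).1
    rw [one_sub_mul_cesaro_geom_sum T hN0]
    exact hN
  refine ⟨hunit, ?_⟩
  have hmul := hlim.const_mul (Ring.inverse (1 - T))
  rw [mul_one] at hmul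
  refine hmul.congr' ?_
  filter_upwards [eventually_ne_atTop 0] with N hN
  rw [← one_sub_mul_cesaro_geom_sum T hN, Ring.inverse_mul_cancel_left _ _ hunit]
end
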